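/- arXiv:1806.10336 — 2 statements merged into one kernel-verified Lean document; each statement's English description precedes it below -/
import Mathlib

section
/- Let (x_n)_{n≥1} be a sequence in [0,1) and let 0 < a < b < 1. Suppose that for every k ∈ ℕ there exists N ∈ ℕ such that x_n ∈ [0,a) ∪ [b,1) for all N < n ≤ N + k, i.e., there are arbitrarily long runs of consecutive elements avoiding [a,b). Then at least one of the intervals [0,a) and [b,1) is not a bounded remainder set (BRS) for (x_n)_{n≥1}. -/
open Finset Filter

/-- Number of indices `1 ≤ n ≤ N` with `x n ∈ [a, b)`. -/
noncomputable def cnt (x : ℕ → ℝ) (a b : ℝ) (N : ℕ) : ℕ :=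
  ((Finset.Icc 1 N).filter (fun n => x n ∈ Set.Ico a b)).card

/-- `[a, b)` is a bounded remainder set (BRS) for the sequence `x`:
`|N * D_N([a,b))| = |#{1 ≤ n ≤ N : x n ∈ [a,b)} - N (b - a)| ≤ c` for all `N`. -/
noncomputable def IsBRS (x : ℕ → ℝ) (a b : ℝ) : Prop :=
  ∃ c : ℝ, ∀ N : ℕ, 1 ≤ N → |((cnt x a b N : ℝ)) - (N : ℝ) * (b - a)| ≤ c

/-- `[a, b)` is a strongly non-bounded remainder set (S-NBRS) for `x`: for every `K`
there are `K` successive elements all in `[a,b)` or all outside `[a,b)`. -/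
def IsSNBRS (x : ℕ → ℝ) (a b : ℝ) : Prop :=
  ∀ K : ℕ, ∃ N : ℕ,
    (∀ k : ℕ, 1 ≤ k → k ≤ K → x (N + k) ∈ Set.Ico a b) ∨
    (∀ k : ℕ, 1 ≤ k → k ≤ K → x (N + k) ∉ Set.Ico a b)

/-- The sequence `x` has a dense collection of BRS. -/
noncomputable def HasDenseBRS (x : ℕ → ℝ) : Prop :=
  ∀ ε : ℝ, 0 < ε → ∀ u v : ℝ, u ∈ Set.Ico (0 : ℝ) 1 → v ∈ Set.Ico (0 : ℝ) 1 →
    ∃ a b : ℝ, 0 ≤ a ∧ a ≤ b ∧ b ≤ 1 ∧ IsBRS x a b ∧ |a - u| < ε ∧ |b - v| < ε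

/-- The sequence `x` is uniformly distributed modulo 1. -/
noncomputable def IsUD (x : ℕ → ℝ) : Prop :=
  ∀ a b : ℝ, 0 ≤ a → a ≤ b → b ≤ 1 →
    Tendsto (fun N : ℕ => (cnt x a b N : ℝ) / (N : ℝ)) atTop (nhds (b - a))

theorem cnt_zero (x : ℕ → ℝ) (a b : ℝ) : cnt x a b 0 = 0 := by
  simp [cnt]

open Classical in
theorem cnt_succ (x : ℕ → ℝ) (a b : ℝ) (N : ℕ) :
    cnt x a b (N + 1) = cnt x a b N + if x (N + 1) ∈ Set.Ico a b then 1 else 0 := by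
  unfold cnt
  rw [← Finset.insert_Icc_right_eq_Icc_add_one (by omega), Finset.filter_insert]
  split_ifs with h
  · rw [Finset.card_insert_of_notMem (by simp)]
  · rfl

theorem cnt_le_cnt_succ (x : ℕ → ℝ) (a b : ℝ) (N : ℕ) :
    cnt x a b N ≤ cnt x a b (N + 1) := by
  rw [cnt_succ]
  exact Nat.le_add_right _ _

/-- Along a run contained in `[a, b) ∪ [c, d)`, the two counts together grow by at least the
length of the run. -/
theorem add_le_cnt_add_cnt_of_run (x : ℕ → ℝ) (a b c d : ℝ) (N k : ℕ)
    (h : ∀ n : ℕ, N < n → n ≤ N + k → x n ∈ Set.Ico a b ∪ Set.Ico c d) :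
    cnt x a b N + cnt x c d N + k ≤ cnt x a b (N + k) + cnt x c d (N + k) := by
  induction k with
  | zero => simp
  | succ k ih =>
    have hk := ih fun n h₁ h₂ => h n h₁ (by omega)
    have hab := cnt_le_cnt_succ x a b (N + k)
    have hcd := cnt_le_cnt_succ x c d (N + k)
    rw [← add_assoc N k 1]
    rcases h (N + k + 1) (by omega) (by omega) with hm | hm
    · have := cnt_succ x a b (N + k)
      rw [if_pos hm] at this
      omega
    · have := cnt_succ x c d (N + k)
      rw [if_pos hm] at this
      omega

/-- The bound in the definition of a bounded remainder set also holds at `N = 0`. -/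
theorem IsBRS.exists_forall_abs_le {x : ℕ → ℝ} {a b : ℝ} (h : IsBRS x a b) :
    ∃ c : ℝ, ∀ N : ℕ, |(cnt x a b N : ℝ) - (N : ℝ) * (b - a)| ≤ c := by
  obtain ⟨c, hc⟩ := h
  refine ⟨c, fun N => ?_⟩
  rcases Nat.eq_zero_or_pos N with rfl | hN
  · simpa [cnt_zero] using (abs_nonneg _).trans (hc 1 le_rfl)
  · exact hc N hN

/-- if a sequence in `[0,1)` has arbitrarily long runs of consecutive
elements avoiding `[a, b)` (i.e. lying in `[0,a) ∪ [b,1)`), then `[0, a)` or `[b, 1)`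
is not a BRS for the sequence. -/
theorem not_brs_of_long_runs_avoiding (x : ℕ → ℝ) (hx : ∀ n : ℕ, 1 ≤ n → x n ∈ Set.Ico (0 : ℝ) 1)
    (a b : ℝ) (ha : 0 < a) (hab : a < b) (hb : b < 1)
    (hruns : ∀ k : ℕ, ∃ N : ℕ, ∀ n : ℕ, N < n → n ≤ N + k →
      x n ∈ Set.Ico (0 : ℝ) a ∪ Set.Ico b 1) :
    ¬ IsBRS x 0 a ∨ ¬ IsBRS x b 1 := by
  by_contra! hcon
  obtain ⟨c, hc⟩ := hcon.1.exists_forall_abs_le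
  obtain ⟨d, hd⟩ := hcon.2.exists_forall_abs_le
  obtain ⟨k, hk⟩ := exists_nat_gt ((2 * c + 2 * d) / (b - a))
  rw [div_lt_iff₀ (sub_pos.mpr hab)] at hk
  obtain ⟨N, hN⟩ := hruns k
  have hrun : (cnt x 0 a N : ℝ) + cnt x b 1 N + k ≤ cnt x 0 a (N + k) + cnt x b 1 (N + k) :=
    mod_cast add_le_cnt_add_cnt_of_run x 0 a b 1 N k hN
  have hc₁ := abs_le.mp (hc N)
  have hc₂ := abs_le.mp (hc (N + k))
  have hd₁ := abs_le.mp (hd N)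
  have hd₂ := abs_le.mp (hd (N + k))
  push_cast at hc₂ hd₂
  nlinarith [hc₁.1, hc₂.2, hd₁.1, hd₂.2]
end

section
/- Let p, q ∈ ℕ and let α_1, α_2, …, α_q be irrational numbers such that 1, α_1, …, α_q are linearly independent over ℚ. Let (x_n)_{n≥1} be the pq-dimensional sequence in [0,1)^{pq} whose components are the numbers {n^{p'} α_{q'}} for 1 ≤ p' ≤ p and 1 ≤ q' ≤ q. Then for every box [0,b) = [0,b_1) × ⋯ × [0,b_{pq}) ⊂ [0,1)^{pq} of positive volume there exists K ∈ ℕ such that among any K consecutive elements x_{N+1}, …, x_{N+K} at least one is contained in [0,b). -/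
open Finset Filter Topology Polynomial MeasureTheory
open scoped FourierTransform ComplexConjugate

/-- Shifting a bounded sum by `h` changes it by at most `2 * h`. -/
lemma norm_sum_range_shift_sub_le {u : ℕ → ℂ} (hu : ∀ n, ‖u n‖ ≤ 1) (K h : ℕ) :
    ‖∑ n ∈ range K, u (n + h) - ∑ n ∈ range K, u n‖ ≤ 2 * h := by
  induction h with
  | zero => simp
  | succ h ih =>
    have key : ∑ n ∈ range K, u (n + (h + 1)) - ∑ n ∈ range K, u n =
        (∑ n ∈ range K, u (n + h) - ∑ n ∈ range K, u n) + (u (K + h) - u h) := by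
      have h1 := sum_range_succ (fun n => u (n + h)) K
      have h2 := sum_range_succ' (fun n => u (n + h)) K
      simp only [zero_add, show ∀ n, n + 1 + h = n + (h + 1) by intro n; ring] at h2
      linear_combination h1 - h2
    rw [key]
    refine (norm_add_le _ _).trans ?_
    have := norm_sub_le (u (K + h)) (u h)
    push_cast
    linarith [hu (K + h), hu h]

/-- The van der Corput inequality, for sequences bounded by `1`. -/
lemma van_der_corput_inequality {u : ℕ → ℂ} (hu : ∀ n, ‖u n‖ ≤ 1) (K H : ℕ) {δ c : ℝ}
    (hδ : 0 ≤ δ) (hc : 0 ≤ c) (hcH : H + H ^ 2 * δ ≤ c ^ 2)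
    (hcorr : ∀ i < H, ∀ j < H, i ≠ j →
      ‖∑ n ∈ range K, u (n + i) * conj (u (n + j))‖ ≤ δ * K) :
    H * ‖∑ n ∈ range K, u n‖ ≤ 2 * H ^ 2 + K * c := by
  have hshift : ‖∑ h ∈ range H, (∑ n ∈ range K, u (n + h) - ∑ n ∈ range K, u n)‖
      ≤ 2 * H ^ 2 := by
    calc _ ≤ ∑ h ∈ range H, (2 * H : ℝ) := by
          refine norm_sum_le_of_le _ fun h hh => (norm_sum_range_shift_sub_le hu K h).trans ?_
          have : (h : ℝ) ≤ H := by exact_mod_cast (mem_range.1 hh).le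
          linarith
      _ = 2 * H ^ 2 := by simp; ring
  rw [sum_sub_distrib, sum_const, card_range, nsmul_eq_mul, sum_comm] at hshift
  have hsq : ∑ n ∈ range K, ‖∑ h ∈ range H, u (n + h)‖ ^ 2 ≤ K * c ^ 2 := by
    have hexp : ((∑ n ∈ range K, ‖∑ h ∈ range H, u (n + h)‖ ^ 2 : ℝ) : ℂ) =
        ∑ i ∈ range H, ∑ j ∈ range H, ∑ n ∈ range K, u (n + i) * conj (u (n + j)) := by
      push_cast
      simp_rw [← Complex.mul_conj', map_sum, sum_mul_sum]
      rw [sum_comm]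
      exact sum_congr rfl fun i _ => sum_comm
    have hnn : 0 ≤ ∑ n ∈ range K, ‖∑ h ∈ range H, u (n + h)‖ ^ 2 :=
      sum_nonneg fun _ _ => by positivity
    rw [← Real.norm_of_nonneg hnn, ← Complex.norm_real, hexp]
    have hterm : ∀ i ∈ range H, ∀ j ∈ range H,
        ‖∑ n ∈ range K, u (n + i) * conj (u (n + j))‖ ≤ (if i = j then (K : ℝ) else 0) + δ * K := by
      intro i hi j hj
      split_ifs with hij
      · refine (norm_sum_le_of_le (n := fun _ => (1 : ℝ)) _ fun n _ => ?_).trans ?_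
        · rw [norm_mul, RCLike.norm_conj]
          exact mul_le_one₀ (hu _) (norm_nonneg _) (hu _)
        · simp; positivity
      · rw [zero_add]
        exact hcorr i (mem_range.1 hi) j (mem_range.1 hj) hij
    refine (norm_sum_le_of_le _ fun i hi => norm_sum_le_of_le _ (hterm i hi)).trans ?_
    have : ∑ i ∈ range H, ∑ j ∈ range H, ((if i = j then (K : ℝ) else 0) + δ * K) =
        K * (H + H ^ 2 * δ) := by
      simp only [sum_add_distrib, sum_ite_eq, sum_ite_mem, sum_const, card_range, nsmul_eq_mul,
        inter_self]
      ring
    rw [this]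
    gcongr
  have hnorm : ‖∑ n ∈ range K, ∑ h ∈ range H, u (n + h)‖ ≤ K * c := by
    refine (norm_sum_le _ _).trans (le_of_sq_le_sq ?_ (by positivity))
    have := sq_sum_le_card_mul_sum_sq (s := range K) (f := fun n => ‖∑ h ∈ range H, u (n + h)‖)
    rw [card_range] at this
    nlinarith [mul_le_mul_of_nonneg_left hsq (Nat.cast_nonneg (α := ℝ) K)]
  have h3 := norm_sub_norm_le ((H : ℂ) * ∑ n ∈ range K, u n)
    (∑ n ∈ range K, ∑ h ∈ range H, u (n + h))
  rw [norm_sub_rev, norm_mul, Complex.norm_natCast] at h3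
  linarith

lemma Real.fourierChar_ne_one_of_irrational {θ : ℝ} (hθ : Irrational θ) : (𝐞 θ : ℂ) ≠ 1 := by
  rw [Real.fourierChar_apply, Ne, Complex.exp_eq_one_iff]
  rintro ⟨n, hn⟩
  refine hθ ⟨n, ?_⟩
  have h : (θ : ℂ) = n := by
    have : (2 * Real.pi * Complex.I : ℂ) ≠ 0 := by simp [Real.pi_ne_zero]
    apply mul_left_cancel₀ this
    push_cast at hn
    linear_combination hn
  exact_mod_cast h.symm

lemma Polynomial.coeff_taylor_of_natDegree_le_succ {R : Type*} [CommSemiring R] {P : R[X]} {d : ℕ}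
    (hP : P.natDegree ≤ d + 1) (r : R) :
    (taylor r P).coeff d = P.coeff d + (d + 1) * P.coeff (d + 1) * r := by
  rw [taylor_coeff, eval_eq_sum_range' (n := 2)]
  · simp [sum_range_succ, hasseDeriv_coeff, add_comm 1 d]
  · have := natDegree_hasseDeriv_le P d
    omega

lemma Polynomial.natDegree_taylor_sub_taylor_le {P : ℝ[X]} {d : ℕ}
    (hP : P.natDegree ≤ d + 1) (r s : ℝ) : (taylor r P - taylor s P).natDegree ≤ d := by
  rw [natDegree_le_iff_coeff_eq_zero]
  intro N hN
  rcases (Nat.succ_le_of_lt hN).eq_or_lt with rfl | hN'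
  · have hP' : P.natDegree ≤ d + 1 + 1 := by omega
    have h0 : P.coeff (d + 1 + 1) = 0 := coeff_eq_zero_of_natDegree_lt (by omega)
    rw [coeff_sub, Nat.succ_eq_add_one, coeff_taylor_of_natDegree_le_succ hP',
      coeff_taylor_of_natDegree_le_succ hP', h0]
    ring
  · refine coeff_eq_zero_of_natDegree_lt ((natDegree_sub_le _ _).trans_lt ?_)
    simp only [natDegree_taylor]
    omega

/-- Weyl's estimate: exponential sums along a real polynomial with irrational leading coefficient
are `o(K)`, uniformly in the lower order coefficients. -/
theorem weyl_exponential_sum (d : ℕ) {θ : ℝ} (hθ : Irrational θ) {ε : ℝ} (hε : 0 < ε) :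
    ∀ᶠ K : ℕ in atTop, ∀ P : ℝ[X], P.natDegree ≤ d + 1 → P.coeff (d + 1) = θ →
      ‖∑ n ∈ range K, (𝐞 (P.eval (n : ℝ)) : ℂ)‖ ≤ ε * K := by
  induction d generalizing θ ε with
  | zero =>
    have h1 := Real.fourierChar_ne_one_of_irrational hθ
    have hpos : 0 < ‖1 - (𝐞 θ : ℂ)‖ := norm_pos_iff.2 (sub_ne_zero.2 h1.symm)
    filter_upwards [(tendsto_natCast_atTop_atTop (R := ℝ)).eventually_ge_atTop
      (2 / (ε * ‖1 - (𝐞 θ : ℂ)‖))] with K hK P hP hPθ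
    have hterm : ∀ n : ℕ, (𝐞 (P.eval (n : ℝ)) : ℂ) = 𝐞 (P.coeff 0) * (𝐞 θ : ℂ) ^ n := by
      intro n
      rw [eval_eq_sum_range' (n := 2) (by omega)]
      simp only [sum_range_succ, range_zero, sum_empty, zero_add, pow_zero, mul_one, pow_one]
      rw [zero_add] at hPθ
      rw [hPθ, AddChar.map_add_eq_mul, mul_comm θ, ← nsmul_eq_mul, AddChar.map_nsmul_eq_pow]
      simp
    simp_rw [hterm]
    rw [← mul_sum, norm_mul, Circle.norm_coe, one_mul]
    have h2 := congrArg norm (mul_neg_geom_sum (𝐞 θ : ℂ) K)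
    rw [norm_mul] at h2
    have h3 : ‖1 - (𝐞 θ : ℂ) ^ K‖ ≤ 2 := by
      refine (norm_sub_le _ _).trans ?_
      rw [norm_pow, Circle.norm_coe]
      norm_num
    rw [div_le_iff₀ (by positivity)] at hK
    refine le_of_mul_le_mul_left ?_ hpos
    rw [h2]
    linarith
  | succ d ih =>
    obtain ⟨H, hH⟩ := exists_nat_gt (8 / ε ^ 2)
    have hHpos : (0 : ℝ) < H := lt_trans (by positivity) hH
    have hcorr : ∀ᶠ K : ℕ in atTop, ∀ i ∈ range H, ∀ j ∈ range H, i ≠ j →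
        ∀ P : ℝ[X], P.natDegree ≤ d + 1 →
          P.coeff (d + 1) = (((d + 2 : ℕ) * ((i : ℤ) - j) : ℤ) : ℝ) * θ →
          ‖∑ n ∈ range K, (𝐞 (P.eval (n : ℝ)) : ℂ)‖ ≤ ε ^ 2 / 8 * K := by
      rw [eventually_all_finset]
      intro i _
      rw [eventually_all_finset]
      intro j _
      rw [eventually_imp_distrib_left]
      intro hij
      refine ih (hθ.intCast_mul (mul_ne_zero (by positivity) (sub_ne_zero.2 ?_))) (by positivity)
      exact_mod_cast hij
    filter_upwards [hcorr, (tendsto_natCast_atTop_atTop (R := ℝ)).eventually_ge_atTop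
      (4 * H / ε)] with K hK hKH P hP hPθ
    have hvdc := van_der_corput_inequality (u := fun n => (𝐞 (P.eval (n : ℝ)) : ℂ))
      (fun n => (Circle.norm_coe _).le) K H (δ := ε ^ 2 / 8) (c := H * (ε / 2))
      (by positivity) (by positivity) ?_ ?_
    · rw [div_le_iff₀ hε] at hKH
      refine le_of_mul_le_mul_left (hvdc.trans ?_) hHpos
      nlinarith
    · rw [div_lt_iff₀ (by positivity)] at hH
      nlinarith
    · intro i hi j hj hij
      have h := hK i (mem_range.2 hi) j (mem_range.2 hj) hij (taylor (i : ℝ) P - taylor (j : ℝ) P)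
        (natDegree_taylor_sub_taylor_le hP _ _) ?_
      · convert h using 4 with n
        rw [eval_sub, taylor_eval, taylor_eval, AddChar.map_sub_eq_div, div_eq_mul_inv,
          Circle.coe_mul, Circle.coe_inv_eq_conj]
        push_cast
        rfl
      · rw [coeff_sub, coeff_taylor_of_natDegree_le_succ hP, coeff_taylor_of_natDegree_le_succ hP,
          hPθ]
        push_cast
        ring

lemma UnitAddTorus.mFourier_coe {ι : Type*} [Fintype ι] (m : ι → ℤ) (t : ι → ℝ) :
    mFourier m (fun i => (t i : UnitAddCircle)) = (𝐞 (∑ i, m i * t i) : ℂ) := by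
  simp only [mFourier, ContinuousMap.coe_mk, fourier_coe_apply, Real.fourierChar_apply,
    ← Complex.exp_sum]
  congr 1
  push_cast
  rw [mul_sum, sum_mul]
  exact sum_congr rfl fun i _ => by ring

/-- The product probability Haar measure on a torus. -/
noncomputable abbrev UnitAddTorus.haar (ι : Type*) [Fintype ι] : Measure (UnitAddTorus ι) :=
  Measure.pi fun _ => AddCircle.haarAddCircle

lemma UnitAddTorus.integral_mFourier_of_ne_zero {ι : Type*} [Fintype ι] {m : ι → ℤ} (hm : m ≠ 0) :
    ∫ x, mFourier m x ∂haar ι = 0 := by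
  obtain ⟨i, hi⟩ := Function.ne_iff.1 hm
  simp only [mFourier, ContinuousMap.coe_mk]
  rw [integral_fintype_prod_eq_prod (fun i (x : UnitAddCircle) => (fourier (m i) x : ℂ))]
  exact prod_eq_zero (mem_univ i)
    (integral_eq_zero_of_add_right_eq_neg (fourier_add_half_inv_index hi one_pos))

/-- Uniform Weyl criterion: if the averages of nontrivial characters tend to `0` uniformly
over windows, then the averages of continuous functions tend to the integral uniformly. -/
lemma UnitAddTorus.eventually_norm_sum_sub_le {ι : Type*} [Fintype ι] {x : ℕ → UnitAddTorus ι}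
    (hx : ∀ m : ι → ℤ, m ≠ 0 → ∀ ε : ℝ, 0 < ε → ∀ᶠ K : ℕ in atTop, ∀ N : ℕ,
      ‖∑ k ∈ range K, mFourier m (x (N + k))‖ ≤ ε * K)
    (f : C(UnitAddTorus ι, ℂ)) {ε : ℝ} (hε : 0 < ε) :
    ∀ᶠ K : ℕ in atTop, ∀ N : ℕ,
      ‖∑ k ∈ range K, (f (x (N + k)) - ∫ y, f y ∂haar ι)‖ ≤ ε * K := by
  have hint : ∀ g : C(UnitAddTorus ι, ℂ), Integrable g (haar ι) := fun g =>
    g.continuous.integrable_of_hasCompactSupport (HasCompactSupport.of_compactSpace g)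
  have hspan : ∀ g ∈ Submodule.span ℂ (Set.range (mFourier (d := ι))), ∀ ε : ℝ, 0 < ε →
      ∀ᶠ K : ℕ in atTop, ∀ N : ℕ,
        ‖∑ k ∈ range K, (g (x (N + k)) - ∫ y, g y ∂haar ι)‖ ≤ ε * K := by
    intro g hg
    induction hg using Submodule.span_induction with
    | mem g hg =>
      obtain ⟨m, rfl⟩ := hg
      intro ε hε
      rcases eq_or_ne m 0 with rfl | hm
      · refine Eventually.of_forall fun K N => ?_
        simp [mFourier_zero]
        positivity
      · simpa only [integral_mFourier_of_ne_zero hm, sub_zero] using hx m hm ε hε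
    | zero =>
      intro ε hε
      refine Eventually.of_forall fun K N => ?_
      simp
      positivity
    | add g h _ _ ihg ihh =>
      intro ε hε
      filter_upwards [ihg (ε / 2) (by positivity), ihh (ε / 2) (by positivity)] with K hg hh N
      have : ∑ k ∈ range K, ((g + h) (x (N + k)) - ∫ y, (g + h) y ∂haar ι) =
          ∑ k ∈ range K, (g (x (N + k)) - ∫ y, g y ∂haar ι) +
          ∑ k ∈ range K, (h (x (N + k)) - ∫ y, h y ∂haar ι) := by
        simp only [ContinuousMap.add_apply]
        rw [integral_add (hint g) (hint h), ← sum_add_distrib]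
        exact sum_congr rfl fun k _ => by ring
      rw [this]
      refine (norm_add_le _ _).trans ?_
      linarith [hg N, hh N]
    | smul a g _ ih =>
      intro ε hε
      filter_upwards [ih (ε / (‖a‖ + 1)) (by positivity)] with K hg N
      have : ∑ k ∈ range K, ((a • g) (x (N + k)) - ∫ y, (a • g) y ∂haar ι) =
          a * ∑ k ∈ range K, (g (x (N + k)) - ∫ y, g y ∂haar ι) := by
        simp only [ContinuousMap.smul_apply, smul_eq_mul]
        rw [integral_const_mul, mul_sum]
        exact sum_congr rfl fun k _ => by ring
      rw [this, norm_mul]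
      calc ‖a‖ * _ ≤ (‖a‖ + 1) * (ε / (‖a‖ + 1) * K) :=
            mul_le_mul (by linarith) (hg N) (norm_nonneg _) (by positivity)
        _ = ε * K := by field_simp
  have hf : f ∈ closure (Submodule.span ℂ (Set.range (mFourier (d := ι))) :
      Set C(UnitAddTorus ι, ℂ)) := by
    rw [← Submodule.topologicalClosure_coe, span_mFourier_closure_eq_top]
    trivial
  obtain ⟨g, hg, hfg⟩ := Metric.mem_closure_iff.1 hf (ε / 3) (by positivity)
  rw [dist_eq_norm] at hfg
  have hpt : ∀ y, ‖f y - g y‖ ≤ ε / 3 := fun y => ((f - g).norm_coe_le_norm y).trans hfg.le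
  have hI : ‖∫ y, g y ∂haar ι - ∫ y, f y ∂haar ι‖ ≤ ε / 3 := by
    rw [norm_sub_rev, ← integral_sub (hint f) (hint g)]
    refine (norm_integral_le_of_norm_le_const (Eventually.of_forall hpt)).trans ?_
    simp
  filter_upwards [hspan g hg (ε / 3) (by positivity)] with K hK N
  have hsplit : ∑ k ∈ range K, (f (x (N + k)) - ∫ y, f y ∂haar ι) =
      ∑ k ∈ range K, (g (x (N + k)) - ∫ y, g y ∂haar ι) +
      ∑ k ∈ range K, ((f (x (N + k)) - g (x (N + k))) +
        (∫ y, g y ∂haar ι - ∫ y, f y ∂haar ι)) := by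
    rw [← sum_add_distrib]
    exact sum_congr rfl fun k _ => by ring
  have herr : ‖∑ k ∈ range K, ((f (x (N + k)) - g (x (N + k))) +
      (∫ y, g y ∂haar ι - ∫ y, f y ∂haar ι))‖ ≤ ∑ k ∈ range K, (ε / 3 + ε / 3) :=
    norm_sum_le_of_le _ fun k _ => norm_add_le_of_le (hpt _) hI
  rw [sum_const, card_range, nsmul_eq_mul] at herr
  rw [hsplit]
  refine (norm_add_le _ _).trans ?_
  linarith [hK N]

/-- Under the uniform Weyl criterion, every nonempty open set is visited with bounded gaps. -/
lemma UnitAddTorus.exists_bounded_gap_of_isOpen {ι : Type*} [Fintype ι] {x : ℕ → UnitAddTorus ι}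
    (hx : ∀ m : ι → ℤ, m ≠ 0 → ∀ ε : ℝ, 0 < ε → ∀ᶠ K : ℕ in atTop, ∀ N : ℕ,
      ‖∑ k ∈ range K, mFourier m (x (N + k))‖ ≤ ε * K)
    {U : Set (UnitAddTorus ι)} (hU : IsOpen U) (hne : U.Nonempty) :
    ∃ K : ℕ, ∀ N : ℕ, ∃ k < K, x (N + k) ∈ U := by
  obtain ⟨c, hc⟩ := hne
  obtain ⟨φ, hφ0, hφ1, hφ⟩ := exists_continuous_zero_one_of_isClosed hU.isClosed_compl
    (isClosed_singleton (x := c)) (by simpa using hc)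
  have hpos : 0 < ∫ y, φ y ∂haar ι :=
    φ.continuous.integral_pos_of_hasCompactSupport_nonneg_nonzero
      (HasCompactSupport.of_compactSpace φ) (fun y => (hφ y).1) (x := c)
      (by rw [hφ1 rfl]; exact one_ne_zero)
  let f : C(UnitAddTorus ι, ℂ) := ⟨fun y => (φ y : ℂ), by fun_prop⟩
  have hf : ∫ y, f y ∂haar ι = ((∫ y, φ y ∂haar ι : ℝ) : ℂ) := integral_ofReal
  obtain ⟨K, hK, hK1⟩ := ((eventually_norm_sum_sub_le hx f (half_pos hpos)).and
    (eventually_ge_atTop 1)).exists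
  refine ⟨K, fun N => ?_⟩
  by_contra! hmiss
  have hzero : ∀ k ∈ range K, f (x (N + k)) - ∫ y, f y ∂haar ι =
      -((∫ y, φ y ∂haar ι : ℝ) : ℂ) := by
    intro k hk
    have : φ (x (N + k)) = 0 := hφ0 (hmiss k (mem_range.1 hk))
    rw [hf]
    simp [f, this]
  have h := hK N
  rw [sum_congr rfl hzero, sum_const, card_range, nsmul_eq_mul, norm_mul, norm_neg,
    Complex.norm_natCast, Complex.norm_real, Real.norm_of_nonneg hpos.le] at h
  have : (1 : ℝ) ≤ K := by exact_mod_cast hK1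
  nlinarith

lemma irrational_sum_int_mul_of_linearIndependent {q : ℕ} {α : Fin q → ℝ}
    (hli : LinearIndependent ℚ (Fin.cons (1 : ℝ) α : Fin (q + 1) → ℝ)) {c : Fin q → ℤ}
    (hc : c ≠ 0) : Irrational (∑ j, c j * α j) := by
  rintro ⟨r, hr⟩
  refine hc (funext fun j => ?_)
  have h := Fintype.linearIndependent_iff.1 hli (Fin.cons (-r) fun j => (c j : ℚ)) (by
    simp [Fin.sum_univ_succ, Algebra.smul_def, ← hr]) j.succ
  simpa using h

lemma fract_eq_of_coe_unitAddCircle_eq {s t : ℝ} (hs : s ∈ Set.Ico (0 : ℝ) 1)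
    (h : (s : UnitAddCircle) = t) : Int.fract t = s := by
  rw [← sub_eq_zero, ← AddCircle.coe_sub, AddCircle.coe_eq_zero_iff] at h
  obtain ⟨n, hn⟩ := h
  rw [Int.fract_eq_iff]
  refine ⟨hs.1, hs.2, -n, ?_⟩
  simp at hn
  push_cast
  linarith

/-- The polynomial whose values are the phases of the character `m` along the sequence
`n ↦ (n ^ (i + 1) * α j)`. -/
noncomputable def phasePolynomial {p q : ℕ} (α : Fin q → ℝ) (m : Fin p × Fin q → ℤ) : ℝ[X] :=
  ∑ i : Fin p, monomial ((i : ℕ) + 1) (∑ j, m (i, j) * α j)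

lemma eval_phasePolynomial {p q : ℕ} (α : Fin q → ℝ) (m : Fin p × Fin q → ℤ) (t : ℝ) :
    (phasePolynomial α m).eval t =
      ∑ i : Fin p × Fin q, (m i : ℝ) * (t ^ ((i.1 : ℕ) + 1) * α i.2) := by
  simp only [phasePolynomial, eval_finsetSum, eval_monomial, Fintype.sum_prod_type, sum_mul]
  exact sum_congr rfl fun i _ => sum_congr rfl fun j _ => by ring

lemma exists_phasePolynomial_degree {p q : ℕ} {α : Fin q → ℝ}
    (hli : LinearIndependent ℚ (Fin.cons (1 : ℝ) α : Fin (q + 1) → ℝ))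
    {m : Fin p × Fin q → ℤ} (hm : m ≠ 0) :
    ∃ d : ℕ, (phasePolynomial α m).natDegree = d + 1 ∧
      Irrational ((phasePolynomial α m).coeff (d + 1)) := by
  obtain ⟨⟨i₀, j₀⟩, h₀⟩ := Function.ne_iff.1 hm
  have hne : ({i | (fun j => m (i, j)) ≠ 0} : Finset (Fin p)).Nonempty :=
    ⟨i₀, by simpa using Function.ne_iff.2 ⟨j₀, h₀⟩⟩
  obtain ⟨d, hd, hmax⟩ := exists_max_image _ id hne
  have hcoeff : (phasePolynomial α m).coeff ((d : ℕ) + 1) = ∑ j, m (d, j) * α j := by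
    simp only [phasePolynomial, finsetSum_coeff, coeff_monomial, Nat.add_right_cancel_iff,
      Fin.val_inj, sum_ite_eq', mem_univ, if_true]
  have hirr : Irrational ((phasePolynomial α m).coeff ((d : ℕ) + 1)) := by
    rw [hcoeff]
    exact irrational_sum_int_mul_of_linearIndependent hli (by simpa using hd)
  refine ⟨d, natDegree_eq_of_le_of_coeff_ne_zero ?_ hirr.ne_zero, hirr⟩
  refine natDegree_sum_le_of_forall_le _ _ fun i _ => ?_
  by_cases hi : (fun j => m (i, j)) = 0
  · have : ∀ j, m (i, j) = 0 := congrFun hi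
    simp [this]
  · refine (natDegree_monomial_le _).trans ?_
    have := hmax i (by simpa using hi)
    simpa using this

/-- if `α₁, …, α_q` are irrational and `1, α₁, …, α_q` are linearly
independent over `ℚ`, then for every box `[0, b₁) × ⋯ × [0, b_{pq}) ⊂ [0,1)^{pq}` of
positive volume there exists `K` such that among any `K` consecutive elements of the
`pq`-dimensional sequence with components `{n^{p'} α_{q'}}` (`1 ≤ p' ≤ p`,
`1 ≤ q' ≤ q`) at least one lies in the box. -/
theorem polynomial_kronecker_hits_corner_box (p q : ℕ) (α : Fin q → ℝ)
    (hirr : ∀ i : Fin q, Irrational (α i))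
    (hli : LinearIndependent ℚ (Fin.cons (1 : ℝ) α : Fin (q + 1) → ℝ))
    (b : Fin p × Fin q → ℝ) (hb : ∀ i : Fin p × Fin q, 0 < b i ∧ b i ≤ 1) :
    ∃ K : ℕ, 1 ≤ K ∧ ∀ N : ℕ, ∃ k : ℕ, 1 ≤ k ∧ k ≤ K ∧
      ∀ i : Fin p × Fin q,
        Int.fract (((N + k : ℕ) : ℝ) ^ ((i.1 : ℕ) + 1) * α i.2) ∈ Set.Ico 0 (b i) := by
  let x : ℕ → UnitAddTorus (Fin p × Fin q) := fun n i =>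
    (((n : ℝ) ^ ((i.1 : ℕ) + 1) * α i.2 : ℝ) : UnitAddCircle)
  let U : Set (UnitAddTorus (Fin p × Fin q)) :=
    Set.univ.pi fun i => ((↑) : ℝ → UnitAddCircle) '' Set.Ioo 0 (b i)
  have hU : IsOpen U := isOpen_set_pi Set.finite_univ fun i _ =>
    QuotientAddGroup.isOpenMap_coe _ isOpen_Ioo
  have hne : U.Nonempty := Set.univ_pi_nonempty_iff.2 fun i =>
    (Set.nonempty_Ioo.2 (hb i).1).image _
  obtain ⟨K, hK⟩ := UnitAddTorus.exists_bounded_gap_of_isOpen (x := x) (fun m hm ε hε => by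
    obtain ⟨d, hd, hirr'⟩ := exists_phasePolynomial_degree hli hm
    filter_upwards [weyl_exponential_sum d hirr' hε] with K hK N
    have h := hK (taylor (N : ℝ) (phasePolynomial α m)) (by rw [natDegree_taylor, hd])
      (by rw [← hd, coeff_taylor_natDegree, leadingCoeff])
    convert h using 4 with k
    rw [UnitAddTorus.mFourier_coe, taylor_eval, eval_phasePolynomial]
    push_cast
    simp only [add_comm]) hU hne
  have hK1 : 1 ≤ K := by
    obtain ⟨k, hk, -⟩ := hK 0
    omega
  refine ⟨K, hK1, fun N => ?_⟩
  obtain ⟨k, hk, hmem⟩ := hK (N + 1)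
  refine ⟨k + 1, by omega, by omega, fun i => ?_⟩
  obtain ⟨s, hs, hst⟩ := hmem i (Set.mem_univ i)
  rw [show N + (k + 1) = N + 1 + k by ring,
    fract_eq_of_coe_unitAddCircle_eq ⟨hs.1.le, hs.2.trans_le (hb i).2⟩ hst]
  exact ⟨hs.1.le, hs.2⟩
end
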